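/- The space of quadratic relations among the 2×2 minors has dimension dim_ℂ (ker Ψ)_2 = binom(m,4)·(n²(n²−1)/12) + (m²(m²−1)/12)·binom(n,4). -/

import Mathlib

open MvPolynomial

/-- Index set for the 2×2 minors of a generic `m × n` matrix:
quadruples `((i,i'),(j,j'))` with `i < i'` and `j < j'`. -/
def MinorIdx (m n : ℕ) : Type :=
  {w : (Fin m × Fin m) × (Fin n × Fin n) // w.1.1 < w.1.2 ∧ w.2.1 < w.2.2}

/-- The 2×2 minor `Δ_{(i,i'),(j,j')} = x_{i,j} x_{i',j'} - x_{i,j'} x_{i',j}`. -/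
noncomputable def minorΔ {m n : ℕ} (w : MinorIdx m n) : MvPolynomial (Fin m × Fin n) ℂ :=
  X (w.1.1.1, w.1.2.1) * X (w.1.1.2, w.1.2.2) - X (w.1.1.1, w.1.2.2) * X (w.1.1.2, w.1.2.1)

/-- The ℂ-algebra map `Ψ : R → S` sending `y_w` to the corresponding 2×2 minor. -/
noncomputable def Psi (m n : ℕ) :
    MvPolynomial (MinorIdx m n) ℂ →ₐ[ℂ] MvPolynomial (Fin m × Fin n) ℂ :=
  aeval minorΔ

/-- The degree `d` graded component of `ker Ψ`, as a ℂ-subspace of `R`. -/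
noncomputable def kerPsiDeg (m n d : ℕ) : Submodule ℂ (MvPolynomial (MinorIdx m n) ℂ) :=
  Submodule.restrictScalars ℂ (RingHom.ker (Psi m n)) ⊓
    homogeneousSubmodule (MinorIdx m n) ℂ d




namespace QRel
open Matrix Equiv
open scoped Kronecker

abbrev S4 := Equiv.Perm (Fin 4)
def ps : S4 := swap 0 1
def pt : S4 := swap 2 3
def pu : S4 := swap 0 2 * swap 1 3
def pr : S4 := swap 1 2 * swap 2 3

section
variable {N : ℕ}

/-- Permutation of tensor positions. -/
def Q (N : ℕ) (σ : S4) : Matrix (Fin 4 → Fin N) (Fin 4 → Fin N) ℂ :=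
  fun x y => if x ∘ σ = y then 1 else 0

lemma Q_mulVec (σ : S4) (f : (Fin 4 → Fin N) → ℂ) (x) : (Q N σ *ᵥ f) x = f (x ∘ σ) := by
  simp [Q, mulVec, dotProduct]

lemma Q_mul (σ τ : S4) : Q N σ * Q N τ = Q N (σ * τ) := by
  ext x y
  simp only [Q, Matrix.mul_apply, ite_mul, one_mul, zero_mul, Finset.sum_ite_eq, Finset.mem_univ, if_true]
  rfl

lemma Q_one : Q N 1 = 1 := by
  ext x y
  simp [Q, Matrix.one_apply]

/-- The alternating projector. -/
noncomputable def AA (N : ℕ) : Matrix (Fin 4 → Fin N) (Fin 4 → Fin N) ℂ :=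
  (1/24 : ℂ) • ∑ σ : S4, ((Perm.sign σ : ℤ) : ℂ) • Q N σ

/-- The projector on the symmetric square of the exterior square. -/
noncomputable def EE (N : ℕ) : Matrix (Fin 4 → Fin N) (Fin 4 → Fin N) ℂ :=
  (1/8 : ℂ) • (Q N 1 - Q N ps - Q N pt + Q N (ps * pt) + Q N pu - Q N (pu * ps) - Q N (pu * pt)
    + Q N (pu * (ps * pt)))

lemma Q_AA (σ : S4) : Q N σ * AA N = ((Perm.sign σ : ℤ) : ℂ) • AA N := by
  simp only [AA, Matrix.mul_smul, Matrix.mul_sum, Q_mul]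
  rw [smul_comm]
  congr 1
  rw [Finset.smul_sum]
  refine Fintype.sum_equiv (Equiv.mulLeft σ) _ _ fun τ => ?_
  simp only [coe_mulLeft, smul_smul, Perm.sign_mul]
  congr 1
  rcases Int.units_eq_one_or (Perm.sign σ) with h | h <;> simp [h]

lemma AA_Q (σ : S4) : AA N * Q N σ = ((Perm.sign σ : ℤ) : ℂ) • AA N := by
  simp only [AA, Matrix.smul_mul, Matrix.sum_mul, Q_mul]
  rw [smul_comm]
  congr 1
  rw [Finset.smul_sum]
  refine Fintype.sum_equiv (Equiv.mulRight σ) _ _ fun τ => ?_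
  simp only [coe_mulRight, smul_smul, Perm.sign_mul]
  congr 1
  rcases Int.units_eq_one_or (Perm.sign σ) with h | h <;> simp [h]

lemma sgn_sq (σ : S4) : ((Perm.sign σ : ℤ) : ℂ) * ((Perm.sign σ : ℤ) : ℂ) = 1 := by
  rcases Int.units_eq_one_or (Perm.sign σ) with h | h <;> simp [h]

lemma AA_AA : AA N * AA N = AA N := by
  conv_lhs => enter [1]; rw [AA]
  simp only [Matrix.smul_mul, Matrix.sum_mul, Q_AA, smul_smul, sgn_sq]
  simp [Finset.card_univ, Fintype.card_perm, Nat.factorial, ← Nat.cast_smul_eq_nsmul ℂ]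

lemma sgn_ps : Perm.sign ps = -1 := by decide
lemma sgn_pt : Perm.sign pt = -1 := by decide
lemma sgn_pu : Perm.sign pu = 1 := by decide
lemma sgn_pr : Perm.sign pr = 1 := by decide

lemma AA_EE : AA N * EE N = AA N := by
  simp only [EE, Matrix.mul_smul, Matrix.mul_add, Matrix.mul_sub, AA_Q, Perm.sign_mul, sgn_ps, sgn_pt,
    sgn_pu]
  simp
  module

lemma EE_AA : EE N * AA N = AA N := by
  simp only [EE, Matrix.smul_mul, Matrix.add_mul, Matrix.sub_mul, Q_AA, Perm.sign_mul, sgn_ps, sgn_pt,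
    sgn_pu]
  simp
  module

lemma ps_EE : Q N ps * EE N = - EE N := by
  simp only [EE, Matrix.mul_smul, Matrix.mul_add, Matrix.mul_sub, Q_mul]
  rw [show ps * 1 = ps by decide, show ps * ps = 1 by decide, show ps * (ps * pt) = pt by decide,
    show ps * pu = pu * pt by decide, show ps * (pu * ps) = pu * (ps * pt) by decide,
    show ps * (pu * pt) = pu by decide, show ps * (pu * (ps * pt)) = pu * ps by decide]
  module

lemma pt_EE : Q N pt * EE N = - EE N := by
  simp only [EE, Matrix.mul_smul, Matrix.mul_add, Matrix.mul_sub, Q_mul]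
  rw [show pt * 1 = pt by decide, show pt * pt = 1 by decide, show pt * (ps * pt) = ps by decide,
    show pt * ps = ps * pt by decide,
    show pt * pu = pu * ps by decide, show pt * (pu * ps) = pu by decide,
    show pt * (pu * pt) = pu * (ps * pt) by decide, show pt * (pu * (ps * pt)) = pu * pt by decide]
  module

lemma pu_EE : Q N pu * EE N = EE N := by
  simp only [EE, Matrix.mul_smul, Matrix.mul_add, Matrix.mul_sub, Q_mul]
  rw [show pu * 1 = pu by decide, show pu * pu = 1 by decide, 
    show pu * (pu * ps) = ps by decide, show pu * (pu * pt) = pt by decide,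
    show pu * (pu * (ps * pt)) = ps * pt by decide]
  module

lemma EE_EE : EE N * EE N = EE N := by
  conv_lhs => enter [1]; rw [EE]
  simp only [Matrix.smul_mul, Matrix.add_mul, Matrix.sub_mul, ← Q_mul, Q_one, Matrix.mul_assoc, ps_EE, pt_EE, pu_EE,
    Matrix.mul_neg, Matrix.one_mul]
  module

lemma trace_AA : (AA N).trace = (N.choose 4 : ℂ) := by
  have h : ∀ x : Fin 4 → Fin N, ∑ σ : S4, ((Perm.sign σ : ℤ) : ℂ) * (Q N σ x x) =
      if Function.Injective x then 1 else 0 := by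
    intro x
    have h1 : ∑ σ : S4, ((Perm.sign σ : ℤ) : ℂ) * (Q N σ x x) =
        (Matrix.of fun a b => if x a = x b then (1:ℂ) else 0).det := by
      rw [Matrix.det_apply]
      refine Finset.sum_congr rfl fun σ _ => ?_
      rw [Units.smul_def, zsmul_eq_mul]
      congr 1
      simp only [Q, Matrix.of_apply, Finset.prod_ite_zero, Finset.prod_const_one]
      simp [funext_iff]
    rw [h1]
    split_ifs with hx
    · rw [show (Matrix.of fun a b => if x a = x b then (1:ℂ) else 0) = 1 from ?_, det_one]
      ext a b
      simp [hx.eq_iff, Matrix.one_apply]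
    · simp only [Function.Injective, not_forall] at hx
      obtain ⟨a, b, hab, hne⟩ := hx
      exact Matrix.det_zero_of_row_eq hne (by ext c; simp [hab])
  have h2 : (AA N).trace = (1/24 : ℂ) * ∑ x : Fin 4 → Fin N, if Function.Injective x then 1 else 0 := by
    simp only [← h]
    simp [AA, Matrix.trace, Matrix.sum_apply, Finset.mul_sum]
  rw [h2]
  have h3 : (Finset.univ.filter fun x : Fin 4 → Fin N => Function.Injective x).card = N.descFactorial 4 := by
    have := Fintype.card_embedding_eq (α := Fin 4) (β := Fin N)
    rw [Fintype.card_fin, Fintype.card_fin] at this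
    rw [← this, ← Fintype.card_subtype]
    exact Fintype.card_congr (Equiv.subtypeInjectiveEquivEmbedding _ _)
  rw [Finset.sum_boole, h3, Nat.descFactorial_eq_factorial_mul_choose]
  simp [Nat.factorial]

lemma sum4 (f : (Fin 4 → Fin N) → ℂ) : ∑ x, f x = ∑ a, ∑ b, ∑ c, ∑ d, f ![a,b,c,d] := by
  rw [← (Fin.consEquiv (fun _ : Fin 4 => Fin N)).sum_comp, Fintype.sum_prod_type]
  refine Finset.sum_congr rfl fun a _ => ?_
  rw [← (Fin.consEquiv (fun _ : Fin 3 => Fin N)).sum_comp, Fintype.sum_prod_type]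
  refine Finset.sum_congr rfl fun b _ => ?_
  rw [← (Fin.consEquiv (fun _ : Fin 2 => Fin N)).sum_comp, Fintype.sum_prod_type]
  refine Finset.sum_congr rfl fun c _ => ?_
  rw [← (Fin.consEquiv (fun _ : Fin 1 => Fin N)).sum_comp, Fintype.sum_prod_type]
  refine Finset.sum_congr rfl fun d _ => ?_
  simp
  rfl

lemma trace_Q (σ : S4) : (Q N σ).trace = ∑ a : Fin N, ∑ b : Fin N, ∑ c : Fin N, ∑ d : Fin N,
    if (![a,b,c,d] (σ 0) = a ∧ ![a,b,c,d] (σ 1) = b ∧ ![a,b,c,d] (σ 2) = c ∧ ![a,b,c,d] (σ 3) = d) 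
      then (1:ℂ) else 0 := by
  rw [Matrix.trace, sum4]
  simp [Q, funext_iff, Fin.forall_fin_succ]

lemma trace_EE : (EE N).trace = ((N:ℂ)^4 - 2 * N^3 + 3 * N^2 - 2 * N) / 8 := by
  have e0 : (Q N 1).trace = (N:ℂ)^4 := by
    rw [trace_Q]
    simp only [show (1 : S4) 0 = 0 by decide, show (1 : S4) 1 = 1 by decide, show (1 : S4) 2 = 2 by decide, show (1 : S4) 3 = 3 by decide]
    simp [ite_and, eq_comm]
    try ring
  have e1 : (Q N ps).trace = (N:ℂ)^3 := by
    rw [trace_Q]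
    simp only [show ps 0 = 1 by decide, show ps 1 = 0 by decide, show ps 2 = 2 by decide, show ps 3 = 3 by decide]
    simp [ite_and, eq_comm]
    try ring
  have e2 : (Q N pt).trace = (N:ℂ)^3 := by
    rw [trace_Q]
    simp only [show pt 0 = 0 by decide, show pt 1 = 1 by decide, show pt 2 = 3 by decide, show pt 3 = 2 by decide]
    simp [ite_and, eq_comm]
    try ring
  have e3 : (Q N (ps * pt)).trace = (N:ℂ)^2 := by
    rw [trace_Q]
    simp only [show (ps * pt) 0 = 1 by decide, show (ps * pt) 1 = 0 by decide, show (ps * pt) 2 = 3 by decide, show (ps * pt) 3 = 2 by decide]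
    simp [ite_and, eq_comm]
    try ring
  have e4 : (Q N pu).trace = (N:ℂ)^2 := by
    rw [trace_Q]
    simp only [show pu 0 = 2 by decide, show pu 1 = 3 by decide, show pu 2 = 0 by decide, show pu 3 = 1 by decide]
    simp [ite_and, eq_comm]
    try ring
  have e5 : (Q N (pu * ps)).trace = (N:ℂ)^1 := by
    rw [trace_Q]
    simp only [show (pu * ps) 0 = 3 by decide, show (pu * ps) 1 = 2 by decide, show (pu * ps) 2 = 0 by decide, show (pu * ps) 3 = 1 by decide]
    simp [ite_and, eq_comm]
    try ring
  have e6 : (Q N (pu * pt)).trace = (N:ℂ)^1 := by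
    rw [trace_Q]
    simp only [show (pu * pt) 0 = 2 by decide, show (pu * pt) 1 = 3 by decide, show (pu * pt) 2 = 1 by decide, show (pu * pt) 3 = 0 by decide]
    simp [ite_and, eq_comm]
    try ring
  have e7 : (Q N (pu * (ps * pt))).trace = (N:ℂ)^2 := by
    rw [trace_Q]
    simp only [show (pu * (ps * pt)) 0 = 3 by decide, show (pu * (ps * pt)) 1 = 2 by decide, show (pu * (ps * pt)) 2 = 1 by decide, show (pu * (ps * pt)) 3 = 0 by decide]
    simp [ite_and, eq_comm]
    try ring
  simp only [EE, Matrix.trace_smul, Matrix.trace_add, Matrix.trace_sub, e0, e1, e2, e3, e4, e5, e6, e7, smul_eq_mul]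
  ring
end
lemma coset_sum (f : S4 → ℂ) (hs : ∀ g, f (g * ps) = f g) (ht : ∀ g, f (g * pt) = f g) :
    ∑ σ, f σ = 4 * (f 1 + f pr + f (pr * pr) + f (1 * pu) + f (pr * pu) + f (pr * pr * pu)) := by
  have hb : Function.Bijective (fun k : Fin 3 × Fin 2 × Fin 2 × Fin 2 =>
      pr ^ (k.1 : ℕ) * pu ^ (k.2.1 : ℕ) * ps ^ (k.2.2.1 : ℕ) * pt ^ (k.2.2.2 : ℕ)) := by
    rw [Fintype.bijective_iff_injective_and_card]
    constructor
    · decide +kernel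
    · simp [Fintype.card_perm, Nat.factorial]
  rw [← hb.sum_comp]
  simp only [Fintype.sum_prod_type, Fin.sum_univ_succ, Fin.sum_univ_zero]
  simp [hs, ht, pow_two]
  have hs1 : f ps = f 1 := by simpa using hs 1
  have ht1 : f pt = f 1 := by simpa using ht 1
  rw [hs1, ht1]
  ring

lemma core (φ : S4 → S4 → ℂ)
    (hs : ∀ g h, φ g (h * ps) = - φ g h) (ht : ∀ g h, φ g (h * pt) = - φ g h)
    (hS : ∀ h, φ 1 (h * 1) + φ pr (h * pr) + φ (pr * pr) (h * (pr * pr)) = 0)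
    (hX : φ 1 1 + φ pr 1 + φ (pr * pr) 1 + φ 1 (1 * pu) + φ pr (1 * pu) + φ (pr * pr) (1 * pu) = 0)
    (hY : φ 1 1 + φ 1 pr + φ 1 (pr * pr) + φ 1 (1 * pu) + φ 1 (pr * pu) + φ 1 (pr * pr * pu) = 0) :
    φ 1 1 = 0 := by
  have k0 := hS 1
  rw [show (1 : S4) * 1 = (1 : S4) by decide, show 1 * pr = pr by decide, show 1 * (pr * pr) = (pr * pr) by decide] at k0
  try simp only [hs, ht] at k0
  have k1 := hS (1 * pt)
  rw [show ((1 : S4) * pt) * 1 = (1 * pt) by decide, show ((1 : S4) * pt) * pr = ((pr * pr) * pt) by decide, show ((1 : S4) * pt) * (pr * pr) = (pr * pt) by decide] at k1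
  try simp only [hs, ht] at k1
  have k2 := hS (pr * pt)
  rw [show (pr * pt) * 1 = (pr * pt) by decide, show (pr * pt) * pr = (1 * pt) by decide, show (pr * pt) * (pr * pr) = ((pr * pr) * pt) by decide] at k2
  try simp only [hs, ht] at k2
  have k3 := hS pr
  rw [show pr * 1 = pr by decide, show pr * pr = (pr * pr) by decide, show pr * (pr * pr) = (1 : S4) by decide] at k3
  try simp only [hs, ht] at k3
  have k4 := hS (pr * pr)
  rw [show (pr * pr) * 1 = (pr * pr) by decide, show (pr * pr) * pr = (1 : S4) by decide, show (pr * pr) * (pr * pr) = pr by decide] at k4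
  try simp only [hs, ht] at k4
  have k5 := hS (1 * ps)
  rw [show ((1 : S4) * ps) * 1 = (1 * ps) by decide, show ((1 : S4) * ps) * pr = (((pr * pr) * pu) * pt) by decide, show ((1 : S4) * ps) * (pr * pr) = ((pr * pu) * ps) by decide] at k5
  try simp only [hs, ht] at k5
  have k6 := hS ((1 * ps) * pt)
  rw [show (((1 : S4) * ps) * pt) * 1 = ((1 * ps) * pt) by decide, show (((1 : S4) * ps) * pt) * pr = (((pr * pu) * ps) * pt) by decide, show (((1 : S4) * ps) * pt) * (pr * pr) = ((pr * pr) * pu) by decide] at k6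
  try simp only [hs, ht] at k6
  have k7 := hS ((pr * pr) * pu)
  rw [show ((pr * pr) * pu) * 1 = ((pr * pr) * pu) by decide, show ((pr * pr) * pu) * pr = ((1 * ps) * pt) by decide, show ((pr * pr) * pu) * (pr * pr) = (((pr * pu) * ps) * pt) by decide] at k7
  try simp only [hs, ht] at k7
  have k8 := hS (((pr * pr) * pu) * pt)
  rw [show (((pr * pr) * pu) * pt) * 1 = (((pr * pr) * pu) * pt) by decide, show (((pr * pr) * pu) * pt) * pr = ((pr * pu) * ps) by decide, show (((pr * pr) * pu) * pt) * (pr * pr) = (1 * ps) by decide] at k8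
  try simp only [hs, ht] at k8
  have k9 := hS ((pr * pu) * ps)
  rw [show ((pr * pu) * ps) * 1 = ((pr * pu) * ps) by decide, show ((pr * pu) * ps) * pr = (1 * ps) by decide, show ((pr * pu) * ps) * (pr * pr) = (((pr * pr) * pu) * pt) by decide] at k9
  try simp only [hs, ht] at k9
  have k10 := hS ((pr * ps) * pt)
  rw [show ((pr * ps) * pt) * 1 = ((pr * ps) * pt) by decide, show ((pr * ps) * pt) * pr = ((((pr * pr) * pu) * ps) * pt) by decide, show ((pr * ps) * pt) * (pr * pr) = (1 * pu) by decide] at k10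
  try simp only [hs, ht] at k10
  have k11 := hS (pr * ps)
  rw [show (pr * ps) * 1 = (pr * ps) by decide, show (pr * ps) * pr = ((1 * pu) * pt) by decide, show (pr * ps) * (pr * pr) = (((pr * pr) * pu) * ps) by decide] at k11
  try simp only [hs, ht] at k11
  have k12 := hS (1 * pu)
  rw [show ((1 : S4) * pu) * 1 = (1 * pu) by decide, show ((1 : S4) * pu) * pr = ((pr * ps) * pt) by decide, show ((1 : S4) * pu) * (pr * pr) = ((((pr * pr) * pu) * ps) * pt) by decide] at k12
  try simp only [hs, ht] at k12
  have k13 := hS ((pr * pr) * ps)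
  rw [show ((pr * pr) * ps) * 1 = ((pr * pr) * ps) by decide, show ((pr * pr) * ps) * pr = ((pr * pu) * pt) by decide, show ((pr * pr) * ps) * (pr * pr) = ((1 * pu) * ps) by decide] at k13
  try simp only [hs, ht] at k13
  linear_combination (1/3) * k0 + (1/6) * k1 + (1/3) * k2 + (1/6) * k3 + (1/6) * k4 + (1/6) * k5 + (2/3) * k6 + (1/6) * k7 + (1/3) * k8 + (1/6) * k9 + (1/6) * k10 + (1/6) * k11 + (-1/3) * k12 + (1/3) * k13 + (1/6) * hX + (1/6) * hY

section
variable {m n : ℕ}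

abbrev Idx (m n : ℕ) := (Fin 4 → Fin m) × (Fin 4 → Fin n)

lemma kron_apply (σ τ : S4) (c : Idx m n → ℂ) (x y) :
    ((Q m σ ⊗ₖ Q n τ) *ᵥ c) (x, y) = c (x ∘ σ, y ∘ τ) := by
  simp only [mulVec, dotProduct, kroneckerMap_apply, Q, Fintype.sum_prod_type, ite_mul, one_mul, zero_mul]
  simp

/-- The symmetry conditions on tensors representing quadrics in the minors. -/
structure TT (c : Idx m n → ℂ) : Prop where
  sx : ∀ x y, c (x ∘ ps, y) = - c (x, y)
  tx : ∀ x y, c (x ∘ pt, y) = - c (x, y)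
  sy : ∀ x y, c (x, y ∘ ps) = - c (x, y)
  ty : ∀ x y, c (x, y ∘ pt) = - c (x, y)
  uu : ∀ x y, c (x ∘ pu, y ∘ pu) = c (x, y)

lemma TT.sub {c d : Idx m n → ℂ} (hc : TT c) (hd : TT d) : TT (c - d) := by
  constructor <;> intro x y
  · simp [hc.sx, hd.sx]; ring
  · simp [hc.tx, hd.tx]; ring
  · simp [hc.sy, hd.sy]; ring
  · simp [hc.ty, hd.ty]; ring
  · simp [hc.uu, hd.uu]

lemma pu_comp {N : ℕ} (x : Fin 4 → Fin N) : (x ∘ pu) ∘ pu = x := by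
  have : pu * pu = 1 := by decide
  rw [Function.comp_assoc, ← Perm.coe_mul, this]; rfl

lemma TT.uux {c : Idx m n → ℂ} (hc : TT c) (x y) : c (x ∘ pu, y) = c (x, y ∘ pu) := by
  rw [← hc.uu x (y ∘ pu), pu_comp]

lemma TT.eq_zero {c : Idx m n → ℂ} (hc : TT c)
    (hS : ∀ x y, ∑ σ : S4, c (x ∘ σ, y ∘ σ) = 0)
    (hX : ∀ x y, ∑ σ : S4, ((Perm.sign σ : ℤ) : ℂ) * c (x ∘ σ, y) = 0)
    (hY : ∀ x y, ∑ σ : S4, ((Perm.sign σ : ℤ) : ℂ) * c (x, y ∘ σ) = 0) : c = 0 := by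
  funext ⟨x, y⟩
  have key := core (fun g h => c (x ∘ g, y ∘ h)) (fun g h => hc.sy (x ∘ g) (y ∘ h))
    (fun g h => hc.ty (x ∘ g) (y ∘ h))
    ?_ ?_ ?_
  · exact key
  · intro h
    have h1 := hS x (y ∘ h)
    rw [coset_sum (fun σ : S4 => c (x ∘ σ, (y ∘ h) ∘ σ))] at h1
    · have u1 : c (x ∘ ⇑(1 * pu), (y ∘ h) ∘ ⇑(1 * pu)) = _ := hc.uu (x ∘ (1 : S4)) ((y ∘ h) ∘ (1 : S4))
      have u2 : c (x ∘ ⇑(pr * pu), (y ∘ h) ∘ ⇑(pr * pu)) = _ := hc.uu (x ∘ pr) ((y ∘ h) ∘ pr)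
      have u3 : c (x ∘ ⇑(pr * pr * pu), (y ∘ h) ∘ ⇑(pr * pr * pu)) = _ :=
        hc.uu (x ∘ ⇑(pr * pr)) ((y ∘ h) ∘ ⇑(pr * pr))
      rw [u1, u2, u3] at h1
      have h2 : 8 * (c (x ∘ (1 : S4), (y ∘ h) ∘ (1 : S4)) + c (x ∘ pr, (y ∘ h) ∘ pr) 
        + c (x ∘ ⇑(pr * pr), (y ∘ h) ∘ ⇑(pr * pr))) = 0 := by linear_combination h1
      have h3 := (mul_eq_zero.1 h2).resolve_left (by norm_num)
      exact h3
    · intro g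
      have := hc.sx (x ∘ g) (((y ∘ h) ∘ g) ∘ ps)
      rw [hc.sy (x ∘ g) ((y ∘ h) ∘ g), neg_neg] at this
      exact this
    · intro g
      have := hc.tx (x ∘ g) (((y ∘ h) ∘ g) ∘ pt)
      rw [hc.ty (x ∘ g) ((y ∘ h) ∘ g), neg_neg] at this
      exact this
  · have h1 := hX x y
    rw [coset_sum (fun σ : S4 => ((Perm.sign σ : ℤ) : ℂ) * c (x ∘ σ, y))] at h1
    · simp only [Perm.sign_mul, sgn_pr, sgn_pu, Perm.sign_one] at h1
      have u1 : c (x ∘ ⇑(1 * pu), y) = _ := hc.uux (x ∘ (1 : S4)) y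
      have u2 : c (x ∘ ⇑(pr * pu), y) = _ := hc.uux (x ∘ pr) y
      have u3 : c (x ∘ ⇑(pr * pr * pu), y) = _ := hc.uux (x ∘ ⇑(pr * pr)) y
      rw [u1, u2, u3] at h1
      have h3 := (mul_eq_zero.1 h1).resolve_left (by norm_num)
      simpa using h3
    · intro g
      have := hc.sx (x ∘ g) y
      have h' : c (x ∘ ⇑(g * ps), y) = - c (x ∘ g, y) := this
      rw [h']; simp [Perm.sign_mul, sgn_ps]
    · intro g
      have := hc.tx (x ∘ g) y
      have h' : c (x ∘ ⇑(g * pt), y) = - c (x ∘ g, y) := this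
      rw [h']; simp [Perm.sign_mul, sgn_pt]
  · have h1 := hY x y
    rw [coset_sum (fun σ : S4 => ((Perm.sign σ : ℤ) : ℂ) * c (x, y ∘ σ))] at h1
    · simp only [Perm.sign_mul, sgn_pr, sgn_pu, Perm.sign_one] at h1
      have h3 := (mul_eq_zero.1 h1).resolve_left (by norm_num)
      simpa using h3
    · intro g
      have := hc.sy x (y ∘ g)
      have h' : c (x, y ∘ ⇑(g * ps)) = - c (x, y ∘ g) := this
      rw [h']; simp [Perm.sign_mul, sgn_ps]
    · intro g
      have := hc.ty x (y ∘ g)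
      have h' : c (x, y ∘ ⇑(g * pt)) = - c (x, y ∘ g) := this
      rw [h']; simp [Perm.sign_mul, sgn_pt]

lemma kron_sub_right {α β : Type*} (A : Matrix α α ℂ) (B C : Matrix β β ℂ) :
    A ⊗ₖ (B - C) = A ⊗ₖ B - A ⊗ₖ C := by
  ext ⟨a, b⟩ ⟨c, d⟩
  simp [kroneckerMap_apply, mul_sub]

lemma kron_sub_left {α β : Type*} (A D : Matrix α α ℂ) (B : Matrix β β ℂ) :
    (A - D) ⊗ₖ B = A ⊗ₖ B - D ⊗ₖ B := by
  ext ⟨a, b⟩ ⟨c, d⟩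
  simp [kroneckerMap_apply, sub_mul]

/-- The projector onto the space of relations. -/
noncomputable def PP (m n : ℕ) : Matrix (Idx m n) (Idx m n) ℂ :=
  AA m ⊗ₖ (EE n - AA n) + (EE m - AA m) ⊗ₖ AA n

lemma PP_PP : PP m n * PP m n = PP m n := by
  have h1 : ∀ N, AA N * (EE N - AA N) = 0 := fun N => by
    rw [Matrix.mul_sub, AA_EE, AA_AA, sub_self]
  have h2 : ∀ N, (EE N - AA N) * AA N = 0 := fun N => by
    rw [Matrix.sub_mul, EE_AA, AA_AA, sub_self]
  have h3 : ∀ N, (EE N - AA N) * (EE N - AA N) = EE N - AA N := fun N => by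
    rw [Matrix.mul_sub, h2, Matrix.sub_mul, EE_EE, AA_EE, sub_zero]
  simp only [PP, Matrix.mul_add, Matrix.add_mul, ← mul_kronecker_mul, h1, h2, h3, AA_AA]
  simp

lemma trace_PP : (PP m n).trace =
    (m.choose 4 : ℂ) * (((n:ℂ)^4 - 2 * n^3 + 3 * n^2 - 2 * n) / 8 - n.choose 4) +
    (((m:ℂ)^4 - 2 * m^3 + 3 * m^2 - 2 * m) / 8 - m.choose 4) * n.choose 4 := by
  simp only [PP, Matrix.trace_add, Matrix.trace_kronecker, Matrix.trace_sub, trace_AA, trace_EE]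

lemma kron_mul_PP (σ τ : S4) (a b : ℂ) (hσ : Q m σ * EE m = a • EE m) (hτ : Q n τ * EE n = b • EE n)
    (ha : ((Perm.sign σ : ℤ) : ℂ) = a) (hb : ((Perm.sign τ : ℤ) : ℂ) = b) :
    (Q m σ ⊗ₖ Q n τ) * PP m n = (a * b) • PP m n := by
  simp only [PP, Matrix.mul_add, ← mul_kronecker_mul, Matrix.mul_sub, hσ, hτ, Q_AA, ha, hb,
    ← smul_sub, smul_kronecker, kronecker_smul, smul_smul, smul_add]
  rw [mul_comm b a]

lemma sym_mul_PP : (∑ σ : S4, Q m σ ⊗ₖ Q n σ) * PP m n = 0 := by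
  have h1 : ∀ N, AA N * (EE N - AA N) = 0 := fun N => by
    rw [Matrix.mul_sub, AA_EE, AA_AA, sub_self]
  have h24 : ∀ N, ∑ σ : S4, ((Perm.sign σ : ℤ) : ℂ) • Q N σ = (24 : ℂ) • AA N := fun N => by
    rw [AA, smul_smul]; norm_num
  have e1 : ∑ σ : S4, (AA m) ⊗ₖ ((((Perm.sign σ : ℤ) : ℂ) • Q n σ) * (EE n - AA n)) = 0 := by
    have : ∑ σ : S4, (AA m) ⊗ₖ ((((Perm.sign σ : ℤ) : ℂ) • Q n σ) * (EE n - AA n)) =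
        (AA m) ⊗ₖ ((∑ σ : S4, (((Perm.sign σ : ℤ) : ℂ) • Q n σ)) * (EE n - AA n)) := by
      ext ⟨a, b⟩ ⟨c, d⟩
      simp [Matrix.sum_mul, Matrix.sum_apply, Finset.mul_sum]
    rw [this, h24, Matrix.smul_mul, h1]; simp
  have e2 : ∑ σ : S4, ((((Perm.sign σ : ℤ) : ℂ) • Q m σ) * (EE m - AA m)) ⊗ₖ (AA n) = 0 := by
    have : ∑ σ : S4, ((((Perm.sign σ : ℤ) : ℂ) • Q m σ) * (EE m - AA m)) ⊗ₖ (AA n) =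
        ((∑ σ : S4, (((Perm.sign σ : ℤ) : ℂ) • Q m σ)) * (EE m - AA m)) ⊗ₖ (AA n) := by
      ext ⟨a, b⟩ ⟨c, d⟩
      simp [Matrix.sum_mul, Matrix.sum_apply, Finset.sum_mul]
    rw [this, h24, Matrix.smul_mul, h1]; simp
  rw [Matrix.sum_mul]
  simp only [PP, Matrix.mul_add, ← mul_kronecker_mul, Q_AA, Finset.sum_add_distrib]
  rw [← add_zero (0 : Matrix (Idx m n) (Idx m n) ℂ)]
  congr 1
  · rw [← e1]
    refine Finset.sum_congr rfl fun σ _ => ?_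
    rw [smul_kronecker, Matrix.smul_mul, kronecker_smul]
  · rw [← e2]
    refine Finset.sum_congr rfl fun σ _ => ?_
    rw [kronecker_smul, Matrix.smul_mul, smul_kronecker]

lemma TT_of_PP {c : Idx m n → ℂ} (h : PP m n *ᵥ c = c) : TT c := by
  have hk : ∀ (σ τ : S4) (a b : ℂ), Q m σ * EE m = a • EE m → Q n τ * EE n = b • EE n →
      ((Perm.sign σ : ℤ) : ℂ) = a → ((Perm.sign τ : ℤ) : ℂ) = b → ∀ x y,
      c (x ∘ σ, y ∘ τ) = (a * b) * c (x, y) := by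
    intro σ τ a b h1 h2 h3 h4 x y
    rw [← kron_apply σ τ c]
    conv_lhs => rw [← h]
    rw [mulVec_mulVec, kron_mul_PP σ τ a b h1 h2 h3 h4, smul_mulVec, h]
    rfl
  have one : ∀ N, Q N 1 * EE N = (1:ℂ) • EE N := fun N => by rw [Q_one]; simp
  have s1 : ∀ N, Q N ps * EE N = (-1:ℂ) • EE N := fun N => by rw [ps_EE]; simp
  have t1 : ∀ N, Q N pt * EE N = (-1:ℂ) • EE N := fun N => by rw [pt_EE]; simp
  have u1 : ∀ N, Q N pu * EE N = (1:ℂ) • EE N := fun N => by rw [pu_EE]; simp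
  constructor <;> intro x y
  · simpa using hk ps 1 (-1) 1 (s1 _) (one _) (by simp [sgn_ps]) (by simp) x y
  · simpa using hk pt 1 (-1) 1 (t1 _) (one _) (by simp [sgn_pt]) (by simp) x y
  · simpa using hk 1 ps 1 (-1) (one _) (s1 _) (by simp) (by simp [sgn_ps]) x y
  · simpa using hk 1 pt 1 (-1) (one _) (t1 _) (by simp) (by simp [sgn_pt]) x y
  · simpa using hk pu pu 1 1 (u1 _) (u1 _) (by simp [sgn_pu]) (by simp [sgn_pu]) x y

lemma sym_apply (c : Idx m n → ℂ) (x y) : 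
    ((∑ σ : S4, Q m σ ⊗ₖ Q n σ) *ᵥ c) (x, y) = ∑ σ : S4, c (x ∘ σ, y ∘ σ) := by
  rw [Matrix.sum_mulVec, Finset.sum_apply]
  simp only [kron_apply]

lemma sym_of_PP {c : Idx m n → ℂ} (h : PP m n *ᵥ c = c) (x y) :
    ∑ σ : S4, c (x ∘ σ, y ∘ σ) = 0 := by
  rw [← sym_apply, ← h, mulVec_mulVec, sym_mul_PP]
  simp

lemma AAx_apply (c : Idx m n → ℂ) (x y) :
    ((AA m ⊗ₖ (1 : Matrix (Fin 4 → Fin n) (Fin 4 → Fin n) ℂ)) *ᵥ c) (x, y) =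
      (1/24) * ∑ σ : S4, ((Perm.sign σ : ℤ) : ℂ) * c (x ∘ σ, y) := by
  have : AA m ⊗ₖ (1 : Matrix (Fin 4 → Fin n) (Fin 4 → Fin n) ℂ) =
      (1/24 : ℂ) • ∑ σ : S4, ((Perm.sign σ : ℤ) : ℂ) • (Q m σ ⊗ₖ Q n 1) := by
    rw [Q_one]
    ext ⟨a, b⟩ ⟨c, d⟩
    simp [AA, Matrix.sum_apply, Finset.sum_mul, Finset.mul_sum, mul_assoc]
  rw [this, smul_mulVec, Matrix.sum_mulVec]
  simp only [smul_mulVec, Pi.smul_apply, Finset.sum_apply, kron_apply, smul_eq_mul]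
  simp

lemma AAy_apply (c : Idx m n → ℂ) (x y) :
    (((1 : Matrix (Fin 4 → Fin m) (Fin 4 → Fin m) ℂ) ⊗ₖ AA n) *ᵥ c) (x, y) =
      (1/24) * ∑ σ : S4, ((Perm.sign σ : ℤ) : ℂ) * c (x, y ∘ σ) := by
  have : (1 : Matrix (Fin 4 → Fin m) (Fin 4 → Fin m) ℂ) ⊗ₖ AA n =
      (1/24 : ℂ) • ∑ σ : S4, ((Perm.sign σ : ℤ) : ℂ) • (Q m 1 ⊗ₖ Q n σ) := by
    rw [Q_one]
    ext ⟨a, b⟩ ⟨c, d⟩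
    simp [AA, Matrix.sum_apply, Finset.mul_sum, mul_assoc, mul_left_comm]
  rw [this, smul_mulVec, Matrix.sum_mulVec]
  simp only [smul_mulVec, Pi.smul_apply, Finset.sum_apply, kron_apply, smul_eq_mul]
  simp


lemma Q_AA_comm {N : ℕ} (σ : S4) : Q N σ * AA N = AA N * Q N σ := by rw [Q_AA, AA_Q]

/-- alternation in the row indices -/
noncomputable def Ax (m n : ℕ) : Matrix (Idx m n) (Idx m n) ℂ :=
  AA m ⊗ₖ (1 : Matrix (Fin 4 → Fin n) (Fin 4 → Fin n) ℂ)
/-- alternation in the column indices -/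
noncomputable def Ay (m n : ℕ) : Matrix (Idx m n) (Idx m n) ℂ :=
  (1 : Matrix (Fin 4 → Fin m) (Fin 4 → Fin m) ℂ) ⊗ₖ AA n

lemma TT_of_comm {M : Matrix (Idx m n) (Idx m n) ℂ}
    (hM : ∀ σ τ : S4, (Q m σ ⊗ₖ Q n τ) * M = M * (Q m σ ⊗ₖ Q n τ)) {c : Idx m n → ℂ} (hc : TT c) :
    TT (M *ᵥ c) := by
  have hk : ∀ (σ τ : S4) (a : ℂ), (∀ x y, c (x ∘ σ, y ∘ τ) = a * c (x, y)) →
      ∀ x y, (M *ᵥ c) (x ∘ σ, y ∘ τ) = a * (M *ᵥ c) (x, y) := by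
    intro σ τ a h x y
    have h' : (Q m σ ⊗ₖ Q n τ) *ᵥ c = a • c := by
      funext ⟨x, y⟩
      rw [kron_apply, h]; rfl
    rw [← kron_apply σ τ (M *ᵥ c), mulVec_mulVec, hM, ← mulVec_mulVec, h', mulVec_smul]
    rfl
  constructor <;> intro x y
  · simpa using hk ps 1 (-1) (by simpa using hc.sx) x y
  · simpa using hk pt 1 (-1) (by simpa using hc.tx) x y
  · simpa using hk 1 ps (-1) (by simpa using hc.sy) x y
  · simpa using hk 1 pt (-1) (by simpa using hc.ty) x y
  · simpa using hk pu pu 1 (by simpa using hc.uu) x y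

lemma Ax_comm (σ τ : S4) : (Q m σ ⊗ₖ Q n τ) * Ax m n = Ax m n * (Q m σ ⊗ₖ Q n τ) := by
  simp [Ax, ← mul_kronecker_mul, Q_AA_comm]

lemma Ay_comm (σ τ : S4) : (Q m σ ⊗ₖ Q n τ) * Ay m n = Ay m n * (Q m σ ⊗ₖ Q n τ) := by
  simp [Ay, ← mul_kronecker_mul, Q_AA_comm]

lemma sym_Ax : (∑ σ : S4, Q m σ ⊗ₖ Q n σ) * Ax m n = (24 : ℂ) • (AA m ⊗ₖ AA n) := by
  have h24 : (24 : ℂ) • AA n = ∑ σ : S4, ((Perm.sign σ : ℤ) : ℂ) • Q n σ := by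
    rw [AA, smul_smul]; norm_num
  rw [← kronecker_smul, h24, Matrix.sum_mul]
  simp only [Ax, ← mul_kronecker_mul, Q_AA, Matrix.mul_one]
  ext ⟨a, b⟩ ⟨c, d⟩
  simp [Matrix.sum_apply, Finset.mul_sum, mul_assoc, mul_left_comm]

lemma sym_Ay : (∑ σ : S4, Q m σ ⊗ₖ Q n σ) * Ay m n = (24 : ℂ) • (AA m ⊗ₖ AA n) := by
  have h24 : (24 : ℂ) • AA m = ∑ σ : S4, ((Perm.sign σ : ℤ) : ℂ) • Q m σ := by
    rw [AA, smul_smul]; norm_num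
  rw [← smul_kronecker, h24, Matrix.sum_mul]
  simp only [Ay, ← mul_kronecker_mul, Q_AA, Matrix.mul_one]
  ext ⟨a, b⟩ ⟨c, d⟩
  simp [Matrix.sum_apply, Finset.sum_mul, mul_assoc, mul_left_comm]

lemma EEy_apply {c : Idx m n → ℂ} (hc : TT c) :
    ((1 : Matrix (Fin 4 → Fin m) (Fin 4 → Fin m) ℂ) ⊗ₖ EE n) *ᵥ c =
      (1/2 : ℂ) • (c + (Q m pu ⊗ₖ Q n 1) *ᵥ c) := by
  have : (1 : Matrix (Fin 4 → Fin m) (Fin 4 → Fin m) ℂ) ⊗ₖ EE n = (1/8 : ℂ) •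
      (Q m 1 ⊗ₖ Q n 1 - Q m 1 ⊗ₖ Q n ps - Q m 1 ⊗ₖ Q n pt + Q m 1 ⊗ₖ Q n (ps * pt) +
      Q m 1 ⊗ₖ Q n pu - Q m 1 ⊗ₖ Q n (pu * ps) - Q m 1 ⊗ₖ Q n (pu * pt)
      + Q m 1 ⊗ₖ Q n (pu * (ps * pt))) := by
    rw [← Q_one]
    simp only [EE, kronecker_smul, kronecker_add, kron_sub_right]
  rw [this]
  funext ⟨x, y⟩
  simp only [smul_mulVec, Matrix.add_mulVec, Matrix.sub_mulVec, Pi.smul_apply, Pi.add_apply, Pi.sub_apply,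
    kron_apply]
  simp only [Perm.coe_mul, ← Function.comp_assoc, hc.sy, hc.ty, Perm.coe_one, Function.comp_id, smul_eq_mul, hc.uux]
  ring

lemma EEx_apply {c : Idx m n → ℂ} (hc : TT c) :
    (EE m ⊗ₖ (1 : Matrix (Fin 4 → Fin n) (Fin 4 → Fin n) ℂ)) *ᵥ c =
      (1/2 : ℂ) • (c + (Q m 1 ⊗ₖ Q n pu) *ᵥ c) := by
  have : EE m ⊗ₖ (1 : Matrix (Fin 4 → Fin n) (Fin 4 → Fin n) ℂ) = (1/8 : ℂ) •
      (Q m 1 ⊗ₖ Q n 1 - Q m ps ⊗ₖ Q n 1 - Q m pt ⊗ₖ Q n 1 + Q m (ps * pt) ⊗ₖ Q n 1 +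
      Q m pu ⊗ₖ Q n 1 - Q m (pu * ps) ⊗ₖ Q n 1 - Q m (pu * pt) ⊗ₖ Q n 1
      + Q m (pu * (ps * pt)) ⊗ₖ Q n 1) := by
    rw [← Q_one]
    simp only [EE, smul_kronecker, add_kronecker, kron_sub_left]
  rw [this]
  funext ⟨x, y⟩
  simp only [smul_mulVec, Matrix.add_mulVec, Matrix.sub_mulVec, Pi.smul_apply, Pi.add_apply, Pi.sub_apply,
    kron_apply]
  simp only [Perm.coe_mul, ← Function.comp_assoc, hc.sx, hc.tx, Perm.coe_one, Function.comp_id, smul_eq_mul, hc.uux]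
  ring

lemma PP_of_TT {c : Idx m n → ℂ} (hc : TT c) (hS : ∀ x y, ∑ σ : S4, c (x ∘ σ, y ∘ σ) = 0) :
    PP m n *ᵥ c = c := by
  have hS' : (∑ σ : S4, Q m σ ⊗ₖ Q n σ) *ᵥ c = 0 := by
    funext ⟨x, y⟩
    rw [sym_apply, hS]; rfl
  have hcomm : (∑ σ : S4, Q m σ ⊗ₖ Q n σ) * Ax m n = Ax m n * (∑ σ : S4, Q m σ ⊗ₖ Q n σ) := by
    rw [Matrix.sum_mul, Matrix.mul_sum]
    exact Finset.sum_congr rfl fun σ _ => Ax_comm σ σ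
  have hAA : (AA m ⊗ₖ AA n) *ᵥ c = 0 := by
    have : (24 : ℂ) • ((AA m ⊗ₖ AA n) *ᵥ c) = 0 := by
      rw [← smul_mulVec, ← sym_Ax, hcomm, ← mulVec_mulVec, hS', mulVec_zero]
    exact (smul_eq_zero.1 this).resolve_left (by norm_num)
  have hAxAx : Ax m n * Ax m n = Ax m n := by
    simp [Ax, ← mul_kronecker_mul, AA_AA]
  have hAyAy : Ay m n * Ay m n = Ay m n := by
    simp [Ay, ← mul_kronecker_mul, AA_AA]
  have hAxAy : Ax m n * Ay m n = AA m ⊗ₖ AA n := by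
    simp [Ax, Ay, ← mul_kronecker_mul]
  have hAyAx : Ay m n * Ax m n = AA m ⊗ₖ AA n := by
    simp [Ax, Ay, ← mul_kronecker_mul]
  have hx : (AA m ⊗ₖ EE n) *ᵥ c = Ax m n *ᵥ c := by
    have h1 : AA m ⊗ₖ EE n = Ax m n * ((1 : Matrix (Fin 4 → Fin m) (Fin 4 → Fin m) ℂ) ⊗ₖ EE n) := by
      simp [Ax, ← mul_kronecker_mul]
    have h2 : Ax m n * (Q m pu ⊗ₖ Q n 1) = Ax m n := by
      rw [Ax, ← mul_kronecker_mul, AA_Q, sgn_pu, Q_one]; simp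
    rw [h1, ← mulVec_mulVec, EEy_apply hc, mulVec_smul, mulVec_add, mulVec_mulVec, h2]
    module
  have hy : (EE m ⊗ₖ AA n) *ᵥ c = Ay m n *ᵥ c := by
    have h1 : EE m ⊗ₖ AA n = Ay m n * (EE m ⊗ₖ (1 : Matrix (Fin 4 → Fin n) (Fin 4 → Fin n) ℂ)) := by
      simp [Ay, ← mul_kronecker_mul]
    have h2 : Ay m n * (Q m 1 ⊗ₖ Q n pu) = Ay m n := by
      rw [Ay, ← mul_kronecker_mul, AA_Q, sgn_pu, Q_one]; simp
    rw [h1, ← mulVec_mulVec, EEx_apply hc, mulVec_smul, mulVec_add, mulVec_mulVec, h2]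
    module
  have hP : PP m n *ᵥ c = Ax m n *ᵥ c + Ay m n *ᵥ c := by
    rw [PP, kron_sub_right, kron_sub_left, Matrix.add_mulVec, Matrix.sub_mulVec, Matrix.sub_mulVec,
      hx, hy, hAA]
    simp
  have hz : c - Ax m n *ᵥ c - Ay m n *ᵥ c = 0 := by
    apply TT.eq_zero ((hc.sub (TT_of_comm Ax_comm hc)).sub (TT_of_comm Ay_comm hc))
    · intro x y
      rw [← sym_apply, mulVec_sub, mulVec_sub, hS', mulVec_mulVec, mulVec_mulVec, sym_Ax, sym_Ay,
        smul_mulVec, hAA]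
      simp
    · intro x y
      have h := AAx_apply (c - Ax m n *ᵥ c - Ay m n *ᵥ c) x y
      have h0 : (AA m ⊗ₖ (1 : Matrix (Fin 4 → Fin n) (Fin 4 → Fin n) ℂ)) *ᵥ
          (c - Ax m n *ᵥ c - Ay m n *ᵥ c) = 0 := by
        rw [← Ax, mulVec_sub, mulVec_sub, mulVec_mulVec, mulVec_mulVec, hAxAx, hAxAy, hAA]
        simp
      rw [h0] at h
      exact (mul_eq_zero.1 h.symm).resolve_left (by norm_num)
    · intro x y
      have h := AAy_apply (c - Ax m n *ᵥ c - Ay m n *ᵥ c) x y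
      have h0 : ((1 : Matrix (Fin 4 → Fin m) (Fin 4 → Fin m) ℂ) ⊗ₖ AA n) *ᵥ
          (c - Ax m n *ᵥ c - Ay m n *ᵥ c) = 0 := by
        rw [← Ay, mulVec_sub, mulVec_sub, mulVec_mulVec, mulVec_mulVec, hAyAy, hAyAx, hAA]
        simp
      rw [h0] at h
      exact (mul_eq_zero.1 h.symm).resolve_left (by norm_num)
  rw [hP]
  rw [sub_sub, sub_eq_zero] at hz
  exact hz.symm

/-- The space of tensors fixed by the projector. -/
noncomputable def KT (m n : ℕ) : Submodule ℂ (Idx m n → ℂ) := LinearMap.range (PP m n).mulVecLin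

lemma mem_KT {c : Idx m n → ℂ} : c ∈ KT m n ↔ PP m n *ᵥ c = c := by
  constructor
  · rintro ⟨d, rfl⟩
    simp [mulVec_mulVec, PP_PP]
  · intro h
    exact ⟨c, by simpa using h⟩

lemma finrank_KT : (Module.finrank ℂ (KT m n) : ℂ) = (PP m n).trace := by
  have h : LinearMap.IsProj (KT m n) (PP m n).mulVecLin :=
    ⟨fun x => ⟨x, rfl⟩, fun x hx => by simpa using mem_KT.1 hx⟩
  rw [← h.trace]
  rw [← Matrix.toLin'_apply', Matrix.trace_toLin'_eq]

lemma curv_dim (n : ℕ) : ((n:ℂ)^4 - 2 * n^3 + 3 * n^2 - 2 * n) / 8 - n.choose 4 =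
    ((n ^ 2 * (n ^ 2 - 1) / 12 : ℕ) : ℂ) := by
  have key : ∀ n : ℕ, 12 ∣ n ^ 2 * (n ^ 2 - 1) := by
    intro n
    rcases Nat.eq_zero_or_pos n with rfl | hn
    · simp
    have h1 : 1 ≤ n ^ 2 := Nat.one_le_pow _ _ hn
    have : ((12 : ℕ) : ℤ) ∣ ((n ^ 2 * (n ^ 2 - 1) : ℕ) : ℤ) := by
      rw [← ZMod.intCast_zmod_eq_zero_iff_dvd]
      push_cast [h1]
      generalize (n : ZMod 12) = z
      revert z
      decide
    exact_mod_cast this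
  have h12 : ((n ^ 2 * (n ^ 2 - 1) / 12 : ℕ) : ℂ) = ((n:ℂ)^2 * (n^2 - 1)) / 12 := by
    rw [Nat.cast_div (key n) (by norm_num)]
    rcases Nat.eq_zero_or_pos n with rfl | hn
    · simp
    have h1 : 1 ≤ n ^ 2 := Nat.one_le_pow _ _ hn
    push_cast [h1]
    rfl
  have hch : (n.choose 4 : ℂ) = (n:ℂ) * (n - 1) * (n - 2) * (n - 3) / 24 := by
    rw [Nat.cast_choose_eq_descPochhammer_div]
    simp [descPochhammer_succ_right, Nat.factorial]
  rw [h12, hch]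
  ring

lemma finrank_KT' : Module.finrank ℂ (KT m n) =
      Nat.choose m 4 * (n ^ 2 * (n ^ 2 - 1) / 12) +
        m ^ 2 * (m ^ 2 - 1) / 12 * Nat.choose n 4 := by
  have h := finrank_KT (m := m) (n := n)
  rw [trace_PP, curv_dim, curv_dim] at h
  exact_mod_cast h
end
section
variable {m n : ℕ}

/-- exponent of the monomial attached to a pair of 4-tuples -/
noncomputable def ex (p : Idx m n) : (Fin m × Fin n) →₀ ℕ :=
  ∑ i, Finsupp.single (p.1 i, p.2 i) 1

lemma ex_eq {p q : Idx m n} (h : ex p = ex q) : ∃ σ : S4, q = (p.1 ∘ σ, p.2 ∘ σ) := by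
  have hc : ∀ v, Nonempty ({i // (q.1 i, q.2 i) = v} ≃ {i // (p.1 i, p.2 i) = v}) := by
    intro v
    rw [← Fintype.card_eq]
    have h1 : ∀ r : Idx m n, Fintype.card {i // (r.1 i, r.2 i) = v} = ex r v := by
      intro r
      rw [Fintype.card_subtype, ex, Finsupp.finsetSum_apply, Finset.card_filter]
      exact Finset.sum_congr rfl fun i _ => by rw [Finsupp.single_apply]
    rw [h1, h1, h]
  let e := fun v => Classical.choice (hc v)
  refine ⟨Equiv.ofFiberEquiv (fun v => e v), ?_⟩
  have := fun i => Equiv.ofFiberEquiv_map (fun v => e v) i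
  ext i
  · exact congrArg (fun t => (t.1 : ℕ)) (this i).symm
  · exact congrArg (fun t => (t.2 : ℕ)) (this i).symm

/-- the polynomial attached to a tensor -/
noncomputable def WW (c : Idx m n → ℂ) : MvPolynomial (Fin m × Fin n) ℂ :=
  ∑ p, monomial (ex p) (c p)

lemma ex_comp (p : Idx m n) (σ : S4) : ex (p.1 ∘ σ, p.2 ∘ σ) = ex p := by
  simp only [ex, Function.comp]
  exact Equiv.sum_comp σ (fun i => Finsupp.single (p.1 i, p.2 i) 1)

/-- the permutation action on indices -/
def actE (σ : S4) : Idx m n ≃ Idx m n where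
  toFun p := (p.1 ∘ σ, p.2 ∘ σ)
  invFun p := (p.1 ∘ ⇑(σ⁻¹), p.2 ∘ ⇑(σ⁻¹))
  left_inv p := by ext <;> simp
  right_inv p := by ext <;> simp

lemma WW_sym (c : Idx m n → ℂ) :
    WW (fun p => ∑ σ : S4, c (p.1 ∘ σ, p.2 ∘ σ)) = (24 : ℂ) • WW c := by
  have h : ∀ σ : S4, WW (fun p => c (p.1 ∘ σ, p.2 ∘ σ)) = WW c := by
    intro σ
    refine Fintype.sum_equiv (actE σ) _ _ fun p => ?_
    simp only [actE, Equiv.coe_fn_mk, ex_comp]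
  have h2 : WW (fun p => ∑ σ : S4, c (p.1 ∘ σ, p.2 ∘ σ)) =
      ∑ σ : S4, WW (fun p => c (p.1 ∘ σ, p.2 ∘ σ)) := by
    simp only [WW, map_sum]
    rw [Finset.sum_comm]
  rw [h2]
  simp only [h]
  simp [Finset.card_univ, Fintype.card_perm, Nat.factorial, ← Nat.cast_smul_eq_nsmul ℂ]

lemma WW_eq_zero (c : Idx m n → ℂ) :
    WW c = 0 ↔ ∀ x y, ∑ σ : S4, c (x ∘ σ, y ∘ σ) = 0 := by
  constructor
  · intro h x y
    have h1 := WW_sym c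
    rw [h, smul_zero] at h1
    have h2 := congrArg (coeff (ex (x, y))) h1
    simp only [WW, coeff_sum, coeff_monomial, coeff_zero] at h2
    rw [← Finset.sum_filter] at h2
    have h3 : ∀ q ∈ Finset.univ.filter (fun q : Idx m n => ex q = ex (x, y)),
        ∑ σ : S4, c (q.1 ∘ σ, q.2 ∘ σ) = ∑ σ : S4, c (x ∘ σ, y ∘ σ) := by
      intro q hq
      rw [Finset.mem_filter] at hq
      obtain ⟨τ, rfl⟩ := ex_eq hq.2.symm
      exact Equiv.sum_comp (Equiv.mulLeft τ) (fun σ : S4 => c (x ∘ σ, y ∘ σ))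
    rw [Finset.sum_congr rfl h3, Finset.sum_const, smul_eq_zero] at h2
    refine h2.resolve_left ?_
    rw [Finset.card_eq_zero]
    exact Finset.Nonempty.ne_empty ⟨(x, y), by simp⟩
  · intro h
    have h1 := WW_sym c
    have h2 : WW (fun p : Idx m n => ∑ σ : S4, c (p.1 ∘ σ, p.2 ∘ σ)) = 0 := by
      simp [WW, h]
    rw [h2] at h1
    exact (smul_eq_zero.1 h1.symm).resolve_left (by norm_num)

/-- index of a signed minor -/
abbrev Qd (m n : ℕ) := Fin m × Fin m × Fin n × Fin n

def fx (α : Qd m n) : Qd m n := (α.2.1, α.1, α.2.2.1, α.2.2.2)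
def fy (α : Qd m n) : Qd m n := (α.1, α.2.1, α.2.2.2, α.2.2.1)

lemma fx_fx (α : Qd m n) : fx (fx α) = α := rfl
lemma fy_fy (α : Qd m n) : fy (fy α) = α := rfl
lemma fy_fx (α : Qd m n) : fy (fx α) = fx (fy α) := rfl
def fxE : Qd m n ≃ Qd m n := ⟨fx, fx, fx_fx, fx_fx⟩
def fyE : Qd m n ≃ Qd m n := ⟨fy, fy, fy_fy, fy_fy⟩

noncomputable def Y0 (α : Qd m n) : MvPolynomial (MinorIdx m n) ℂ :=
  if h : α.1 < α.2.1 ∧ α.2.2.1 < α.2.2.2 then X ⟨((α.1, α.2.1), (α.2.2.1, α.2.2.2)), h⟩ else 0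

/-- signed variable -/
noncomputable def YY (α : Qd m n) : MvPolynomial (MinorIdx m n) ℂ :=
  Y0 α - Y0 (fx α) - Y0 (fy α) + Y0 (fx (fy α))

noncomputable def dd (γ α : Qd m n) : ℂ :=
  (if α = γ then 1 else 0) - (if α = fx γ then 1 else 0) - (if α = fy γ then 1 else 0)
    + (if α = fx (fy γ) then 1 else 0)

/-- the quadruple of a minor index -/
def qd (w : MinorIdx m n) : Qd m n := (w.1.1.1, w.1.1.2, w.1.2.1, w.1.2.2)

structure Anti {M : Type*} [AddCommGroup M] (f : Qd m n → M) : Prop where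
  x : ∀ α, f (fx α) = - f α
  y : ∀ α, f (fy α) = - f α

lemma Anti.zero_x {M : Type*} [AddCommGroup M] [Module ℂ M] {f : Qd m n → M} (hf : Anti f) {α : Qd m n}
    (h : α.1 = α.2.1) : f α = 0 := by
  have h1 := hf.x α
  rw [show fx α = α by obtain ⟨a, b, c, d⟩ := α; simp at h; simp [fx, h]] at h1
  have h2 : (2 : ℂ) • f α = 0 := by 
    rw [two_smul]; nth_rw 1 [h1]; simp
  exact (smul_eq_zero.1 h2).resolve_left (by norm_num)

lemma Anti.zero_y {M : Type*} [AddCommGroup M] [Module ℂ M] {f : Qd m n → M} (hf : Anti f) {α : Qd m n}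
    (h : α.2.2.1 = α.2.2.2) : f α = 0 := by
  have h1 := hf.y α
  rw [show fy α = α by obtain ⟨a, b, c, d⟩ := α; simp at h; simp [fy, h]] at h1
  have h2 : (2 : ℂ) • f α = 0 := by 
    rw [two_smul]; nth_rw 1 [h1]; simp
  exact (smul_eq_zero.1 h2).resolve_left (by norm_num)

/-- Antisymmetric functions are determined by their values on sorted quadruples. -/
lemma Anti.ext {M : Type*} [AddCommGroup M] [Module ℂ M] {f g : Qd m n → M} (hf : Anti f) (hg : Anti g)
    (h : ∀ w : MinorIdx m n, f (qd w) = g (qd w)) : f = g := by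
  have h1 : ∀ α : Qd m n, α.1 < α.2.1 → α.2.2.1 < α.2.2.2 → f α = g α := fun α ha hb =>
    h ⟨((α.1, α.2.1), (α.2.2.1, α.2.2.2)), ha, hb⟩
  have h2 : ∀ α : Qd m n, α.1 < α.2.1 → f α = g α := by
    intro α ha
    rcases lt_trichotomy α.2.2.1 α.2.2.2 with hb | hb | hb
    · exact h1 α ha hb
    · rw [hf.zero_y hb, hg.zero_y hb]
    · have := h1 (fy α) ha hb
      rwa [hf.y, hg.y, neg_inj] at this
  funext α
  rcases lt_trichotomy α.1 α.2.1 with ha | ha | ha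
  · exact h2 α ha
  · rw [hf.zero_x ha, hg.zero_x ha]
  · have := h2 (fx α) ha
    rwa [hf.x, hg.x, neg_inj] at this

lemma YY_anti : Anti (YY (m := m) (n := n)) := by
  constructor <;> intro α <;> simp only [YY, fx_fx, fy_fy, fy_fx] <;> abel

lemma fx_eq_iff (α γ : Qd m n) : fx α = γ ↔ α = fx γ := 
  ⟨fun h => by rw [← h, fx_fx], fun h => by rw [h, fx_fx]⟩
lemma fy_eq_iff (α γ : Qd m n) : fy α = γ ↔ α = fy γ := 
  ⟨fun h => by rw [← h, fy_fy], fun h => by rw [h, fy_fy]⟩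

lemma dd_anti (γ : Qd m n) : Anti (dd γ) := by
  constructor <;> intro α <;> simp only [dd, fx_eq_iff, fy_eq_iff, fx_fx, fy_fy, fy_fx] <;> ring

lemma sum_dd {M : Type*} [AddCommGroup M] [Module ℂ M] {f : Qd m n → M} (hf : Anti f) (γ : Qd m n) :
    ∑ α, dd γ α • f α = (4 : ℂ) • f γ := by
  simp only [dd, add_smul, sub_smul, ite_smul, one_smul, zero_smul, Finset.sum_add_distrib,
    Finset.sum_sub_distrib, Finset.sum_ite_eq', Finset.mem_univ, if_true, hf.x, hf.y]
  module

lemma YY_qd (w : MinorIdx m n) : YY (qd w) = X w := by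
  obtain ⟨⟨⟨a, b⟩, ⟨c, d⟩⟩, h1, h2⟩ := w
  simp only at h1 h2
  simp only [YY, Y0, qd, fx, fy]
  simp [h1, h2, h1.not_gt, h2.not_gt]

/-- the image of a signed variable -/
noncomputable def MM (α : Qd m n) : MvPolynomial (Fin m × Fin n) ℂ :=
  X (α.1, α.2.2.1) * X (α.2.1, α.2.2.2)

lemma Psi_YY : (fun α => Psi m n (YY α)) = fun α => MM α - MM (fy α) := by
  apply Anti.ext
  · constructor <;> intro α
    · rw [YY_anti.x, map_neg]
    · rw [YY_anti.y, map_neg]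
  · constructor <;> intro α <;> simp only [MM, fx, fy] <;> ring
  · intro w
    rw [YY_qd]
    simp [Psi, minorΔ, MM, qd, fy]

/-- signed derivation -/
noncomputable def DD (γ : Qd m n) :
    Derivation ℂ (MvPolynomial (MinorIdx m n) ℂ) (MvPolynomial (MinorIdx m n) ℂ) :=
  mkDerivation ℂ fun w => C (dd γ (qd w))

lemma DD_YY (γ : Qd m n) : (fun α => DD γ (YY α)) = fun α => C (dd γ α) := by
  apply Anti.ext
  · constructor <;> intro α
    · rw [YY_anti.x, map_neg]
    · rw [YY_anti.y, map_neg]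
  · constructor <;> intro α
    · rw [(dd_anti γ).x, map_neg]
    · rw [(dd_anti γ).y, map_neg]
  · intro w
    rw [YY_qd, DD, mkDerivation_X]

lemma DD_sum (γ : Qd m n) {f : Qd m n → ℂ} (hf : Anti f) :
    DD γ (∑ α, f α • YY α) = C (4 * f γ) := by
  have h : ∀ α, DD γ (YY α) = C (dd γ α) := fun α => congrFun (DD_YY γ) α
  simp only [map_sum, Derivation.map_smul, h]
  have := sum_dd hf γ
  simp only [smul_eq_mul] at this
  rw [← this, map_sum]
  refine Finset.sum_congr rfl fun α _ => ?_
  rw [C_mul, MvPolynomial.smul_eq_C_mul, mul_comm]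
end
section
variable {m n : ℕ}

/-- regrouping of indices -/
def eE : Qd m n × Qd m n ≃ Idx m n where
  toFun p := (![p.1.1, p.1.2.1, p.2.1, p.2.2.1], ![p.1.2.2.1, p.1.2.2.2, p.2.2.2.1, p.2.2.2.2])
  invFun q := ((q.1 0, q.1 1, q.2 0, q.2 1), (q.1 2, q.1 3, q.2 2, q.2 3))
  left_inv p := rfl
  right_inv q := by
    ext i <;> fin_cases i <;> rfl

lemma v_ps {N : ℕ} (a b c d : Fin N) : ![a, b, c, d] ∘ ps = ![b, a, c, d] := by
  ext i; fin_cases i <;> rfl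
lemma v_pt {N : ℕ} (a b c d : Fin N) : ![a, b, c, d] ∘ pt = ![a, b, d, c] := by
  ext i; fin_cases i <;> rfl
lemma v_pu {N : ℕ} (a b c d : Fin N) : ![a, b, c, d] ∘ pu = ![c, d, a, b] := by
  ext i; fin_cases i <;> rfl

/-- symmetry conditions in terms of quadruples -/
structure TQ (c : Idx m n → ℂ) : Prop where
  a : ∀ β, Anti (fun α => c (eE (α, β)))
  s : ∀ α β, c (eE (α, β)) = c (eE (β, α))

lemma TQ.b {c : Idx m n → ℂ} (h : TQ c) (α) : Anti (fun β => c (eE (α, β))) := by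
  constructor <;> intro β
  · rw [h.s, (h.a α).x, h.s α]
  · rw [h.s, (h.a α).y, h.s α]

lemma TT_iff {c : Idx m n → ℂ} : TT c ↔ TQ c := by
  constructor
  · intro h
    constructor
    · rintro ⟨c1, d1, g, h'⟩
      constructor
      · rintro ⟨a, b, e, f⟩
        have := h.sx ![a, b, c1, d1] ![e, f, g, h']
        rw [v_ps] at this
        exact this
      · rintro ⟨a, b, e, f⟩
        have := h.sy ![a, b, c1, d1] ![e, f, g, h']
        rw [v_ps] at this
        exact this
    · rintro ⟨a, b, e, f⟩ ⟨c1, d1, g, h'⟩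
      have := h.uu ![a, b, c1, d1] ![e, f, g, h']
      rw [v_pu, v_pu] at this
      exact this.symm
  · intro h
    have key : ∀ P : (Fin 4 → Fin m) → (Fin 4 → Fin n) → Prop,
        (∀ a b c d e f g h, P ![a, b, c, d] ![e, f, g, h]) → ∀ x y, P x y := by
      intro P hP x y
      have hx : x = ![x 0, x 1, x 2, x 3] := by ext i; fin_cases i <;> rfl
      have hy : y = ![y 0, y 1, y 2, y 3] := by ext i; fin_cases i <;> rfl
      rw [hx, hy]
      exact hP _ _ _ _ _ _ _ _
    constructor
    · refine key _ fun a b c1 d1 e f g h' => ?_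
      rw [v_ps]
      exact (h.a (c1, d1, g, h')).x (a, b, e, f)
    · refine key _ fun a b c1 d1 e f g h' => ?_
      rw [v_pt]
      exact (h.b (a, b, e, f)).x (c1, d1, g, h')
    · refine key _ fun a b c1 d1 e f g h' => ?_
      rw [v_ps]
      exact (h.a (c1, d1, g, h')).y (a, b, e, f)
    · refine key _ fun a b c1 d1 e f g h' => ?_
      rw [v_pt]
      exact (h.b (a, b, e, f)).y (c1, d1, g, h')
    · refine key _ fun a b c1 d1 e f g h' => ?_
      rw [v_pu, v_pu]
      exact (h.s (a, b, e, f) (c1, d1, g, h')).symm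

/-- the quadric attached to a tensor -/
noncomputable def GG (m n : ℕ) : (Idx m n → ℂ) →ₗ[ℂ] MvPolynomial (MinorIdx m n) ℂ where
  toFun c := ∑ α, ∑ β, c (eE (α, β)) • (YY α * YY β)
  map_add' c d := by simp [add_smul, Finset.sum_add_distrib]
  map_smul' a c := by simp [mul_smul, Finset.smul_sum]

lemma GG_apply (c : Idx m n → ℂ) : GG m n c = ∑ α, ∑ β, c (eE (α, β)) • (YY α * YY β) := rfl

lemma GG_inj {c : Idx m n → ℂ} (hc : TQ c) (h : GG m n c = 0) : c = 0 := by
  set L : Qd m n → MvPolynomial (MinorIdx m n) ℂ := fun α => ∑ β, c (eE (α, β)) • YY β with hL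
  have hG : GG m n c = ∑ α, YY α * L α := by
    rw [GG_apply]
    refine Finset.sum_congr rfl fun α _ => ?_
    rw [hL, Finset.mul_sum]
    exact Finset.sum_congr rfl fun β _ => by rw [mul_smul_comm]
  have hLa : Anti L := by
    constructor <;> intro α <;> simp only [hL, ← Finset.sum_neg_distrib, ← neg_smul]
    · exact Finset.sum_congr rfl fun β _ => by rw [(hc.a β).x]
    · exact Finset.sum_congr rfl fun β _ => by rw [(hc.a β).y]
  have hD : ∀ γ α : Qd m n, DD γ (YY α) = C (dd γ α) := fun γ α => congrFun (DD_YY γ) α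
  have hDL : ∀ γ α : Qd m n, DD γ (L α) = C (4 * c (eE (α, γ))) := fun γ α => DD_sum γ (hc.b α)
  have h8 : ∀ γ, (8 : ℂ) • L γ = 0 := by
    intro γ
    have h1 : DD γ (GG m n c) = 0 := by rw [h, map_zero]
    rw [hG, map_sum] at h1
    simp only [Derivation.leibniz, hD, hDL, Finset.sum_add_distrib, smul_eq_mul] at h1
    have h2 : ∑ α, L α * C (dd γ α) = (4 : ℂ) • L γ := by
      rw [← sum_dd hLa γ]
      exact Finset.sum_congr rfl fun α _ => by rw [MvPolynomial.smul_eq_C_mul, mul_comm]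
    have h3 : ∑ α, YY α * C (4 * c (eE (α, γ))) = (4 : ℂ) • L γ := by
      rw [hL, Finset.smul_sum]
      exact Finset.sum_congr rfl fun α _ => by
        rw [smul_smul, MvPolynomial.smul_eq_C_mul, mul_comm, hc.s]
    rw [h2, h3] at h1
    rw [← h1]
    module
  have hz : ∀ γ δ, c (eE (γ, δ)) = 0 := by
    intro γ δ
    have h1 : L γ = 0 := (smul_eq_zero.1 (h8 γ)).resolve_left (by norm_num)
    have h2 := hDL δ γ
    rw [h1, map_zero, eq_comm, C_eq_zero] at h2
    exact (mul_eq_zero.1 h2).resolve_left (by norm_num)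
  funext p
  have := hz (eE.symm p).1 (eE.symm p).2
  simpa using this

lemma sum_MM {f : Qd m n → ℂ} (hf : Anti f) :
    ∑ α, f α • (MM α - MM (fy α)) = (2 : ℂ) • ∑ α, f α • MM α := by
  have h : ∑ α, f α • MM (fy α) = - ∑ α, f α • MM α := by
    rw [← Finset.sum_neg_distrib]
    refine Fintype.sum_equiv fyE _ _ fun α => ?_
    change f α • MM (fy α) = - (f (fy α) • MM (fy α))
    rw [hf.y]; simp
  simp only [smul_sub, Finset.sum_sub_distrib, h]
  module

lemma WW_eq (c : Idx m n → ℂ) : WW c = ∑ α, ∑ β, c (eE (α, β)) • (MM α * MM β) := by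
  rw [WW, ← eE.sum_comp, Fintype.sum_prod_type]
  refine Finset.sum_congr rfl fun α _ => Finset.sum_congr rfl fun β _ => ?_
  generalize c (eE (α, β)) = z
  simp only [MM, X, monomial_mul, smul_monomial, ex, Fin.sum_univ_four]
  simp [eE, add_assoc]
  rfl

lemma Psi_GG {c : Idx m n → ℂ} (hc : TQ c) : Psi m n (GG m n c) = (4 : ℂ) • WW c := by
  have hP : ∀ α, Psi m n (YY α) = MM α - MM (fy α) := fun α => congrFun Psi_YY α
  rw [GG_apply]
  simp only [map_sum, map_smul, map_mul, hP]
  have h1 : ∀ α, ∑ β, c (eE (α, β)) • ((MM α - MM (fy α)) * (MM β - MM (fy β))) =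
      (2 : ℂ) • ∑ β, c (eE (α, β)) • ((MM α - MM (fy α)) * MM β) := by
    intro α
    simp only [← mul_smul_comm, ← Finset.mul_sum]
    rw [sum_MM (hc.b α), mul_smul_comm]
  simp only [h1]
  rw [← Finset.smul_sum, Finset.sum_comm]
  have h2 : ∀ β, ∑ α, c (eE (α, β)) • ((MM α - MM (fy α)) * MM β) =
      (2 : ℂ) • ∑ α, c (eE (α, β)) • (MM α * MM β) := by
    intro β
    simp only [← smul_mul_assoc, ← Finset.sum_mul]
    rw [sum_MM (hc.a β), smul_mul_assoc]
  simp only [h2]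
  rw [← Finset.smul_sum, Finset.sum_comm, ← WW_eq, smul_smul]
  norm_num

/-- the space of tensors with the right symmetries -/
def TS (m n : ℕ) : Submodule ℂ (Idx m n → ℂ) where
  carrier := {c | TQ c}
  add_mem' {c d} hc hd := by
    refine ⟨fun β => ⟨fun α => ?_, fun α => ?_⟩, fun α β => ?_⟩
    · simp only [Pi.add_apply, (hc.a β).x, (hd.a β).x]; ring
    · simp only [Pi.add_apply, (hc.a β).y, (hd.a β).y]; ring
    · simp only [Pi.add_apply, hc.s α β, hd.s α β]
  zero_mem' := ⟨fun β => ⟨fun α => by simp, fun α => by simp⟩, fun α β => by simp⟩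
  smul_mem' a c hc := by
    refine ⟨fun β => ⟨fun α => ?_, fun α => ?_⟩, fun α β => ?_⟩
    · simp only [Pi.smul_apply, (hc.a β).x, smul_neg]
    · simp only [Pi.smul_apply, (hc.a β).y, smul_neg]
    · simp only [Pi.smul_apply, hc.s α β]

lemma XX_mem (w v : MinorIdx m n) :
    (X w * X v : MvPolynomial (MinorIdx m n) ℂ) ∈ (TS m n).map (GG m n) := by
  let c : Idx m n → ℂ := fun p => (1/32) * (dd (qd w) (eE.symm p).1 * dd (qd v) (eE.symm p).2 +
    dd (qd v) (eE.symm p).1 * dd (qd w) (eE.symm p).2)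
  have hc : ∀ α β, c (eE (α, β)) = (1/32) * (dd (qd w) α * dd (qd v) β + dd (qd v) α * dd (qd w) β) := by
    intro α β
    simp only [c, Equiv.symm_apply_apply]
  refine ⟨c, ⟨fun β => ⟨fun α => ?_, fun α => ?_⟩, fun α β => ?_⟩, ?_⟩
  · simp only [hc, (dd_anti _).x]; ring
  · simp only [hc, (dd_anti _).y]; ring
  · simp only [hc]; ring
  · rw [GG_apply]
    have hs : ∀ u : MinorIdx m n, ∑ α, dd (qd u) α • YY α = (4 : ℂ) • X u := by
      intro u
      rw [sum_dd YY_anti, YY_qd]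
    have h1 : ∀ u z : MinorIdx m n, ∑ α, ∑ β, (dd (qd u) α * dd (qd z) β) • (YY α * YY β) =
        (16 : ℂ) • (X u * X z : MvPolynomial (MinorIdx m n) ℂ) := by
      intro u z
      have : (∑ α, dd (qd u) α • YY α) * (∑ β, dd (qd z) β • YY β) =
          ∑ α, ∑ β, (dd (qd u) α * dd (qd z) β) • (YY α * YY β) := by
        rw [Finset.sum_mul_sum]
        exact Finset.sum_congr rfl fun α _ => Finset.sum_congr rfl fun β _ => by
          rw [smul_mul_smul_comm]
      rw [← this, hs, hs, smul_mul_smul_comm]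
      norm_num
    simp only [hc, mul_smul, ← Finset.smul_sum]
    simp only [add_smul, Finset.sum_add_distrib, h1]
    rw [mul_comm (X v) (X w)]
    module

lemma homog_le : homogeneousSubmodule (MinorIdx m n) ℂ 2 ≤ (TS m n).map (GG m n) := by
  intro p hp
  rw [mem_homogeneousSubmodule] at hp
  rw [p.as_sum]
  refine Submodule.sum_mem _ fun d hd => ?_
  have hdeg : d.degree = 2 := by
    have := hp (mem_support_iff.1 hd)
    rwa [Finsupp.degree_eq_weight_one]
  have hcard : Multiset.card (Finsupp.toMultiset d) = 2 := by
    rw [Finsupp.card_toMultiset]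
    exact hdeg
  obtain ⟨w, v, hwv⟩ := Multiset.card_eq_two.1 hcard
  have hd2 : d = Finsupp.single w 1 + Finsupp.single v 1 := by
    classical
    have h := congrArg Multiset.toFinsupp hwv
    rw [Finsupp.toMultiset_toFinsupp] at h
    rw [h, ← Multiset.toFinsupp_singleton, ← Multiset.toFinsupp_singleton, ← map_add]
    rfl
  have h3 : monomial d (coeff d p) = coeff d p • (X w * X v) := by
    rw [X, X, monomial_mul, smul_monomial, ← hd2]; simp
  rw [h3]
  exact Submodule.smul_mem _ _ (XX_mem w v)

lemma YY_homog (α : Qd m n) : (YY α).IsHomogeneous 1 := by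
  have h0 : ∀ α : Qd m n, (Y0 α).IsHomogeneous 1 := by
    intro α
    rw [Y0]
    split_ifs
    · exact isHomogeneous_X _ _
    · exact isHomogeneous_zero _ _ _
  exact (((h0 _).sub (h0 _)).sub (h0 _)).add (h0 _)

lemma GG_homog (c : Idx m n → ℂ) : GG m n c ∈ homogeneousSubmodule (MinorIdx m n) ℂ 2 := by
  rw [GG_apply]
  refine Submodule.sum_mem _ fun α _ => Submodule.sum_mem _ fun β _ => Submodule.smul_mem _ _ ?_
  exact (YY_homog α).mul (YY_homog β)

lemma ker_eq : kerPsiDeg m n 2 = (KT m n).map (GG m n) := by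
  ext p
  constructor
  · rintro ⟨h1, h2⟩
    obtain ⟨c, hc, rfl⟩ := homog_le h2
    have hc' : TQ c := hc
    refine ⟨c, ?_, rfl⟩
    have h3 : Psi m n (GG m n c) = 0 := h1
    rw [Psi_GG hc'] at h3
    have h4 := (smul_eq_zero.1 h3).resolve_left (by norm_num)
    exact mem_KT.2 (PP_of_TT (TT_iff.2 hc') ((WW_eq_zero c).1 h4))
  · rintro ⟨c, hc, rfl⟩
    have hP := mem_KT.1 hc
    refine ⟨?_, GG_homog c⟩
    change Psi m n (GG m n c) = 0
    rw [Psi_GG (TT_iff.1 (TT_of_PP hP)), (WW_eq_zero c).2 (sym_of_PP hP), smul_zero]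

lemma finrank_ker : Module.finrank ℂ (kerPsiDeg m n 2) = Module.finrank ℂ (KT m n) := by
  rw [ker_eq]
  have hinj : Function.Injective ((GG m n).domRestrict (KT m n)) := by
    rw [← LinearMap.ker_eq_bot, LinearMap.ker_eq_bot']
    rintro ⟨c, hc⟩ h
    have : c = 0 := GG_inj (TT_iff.1 (TT_of_PP (mem_KT.1 hc))) h
    exact Subtype.ext this
  have := LinearMap.finrank_range_of_inj hinj
  rw [← this, LinearMap.range_domRestrict]
end
end QRel

/-- The space of quadratic relations among the 2×2 minors has dimension
`C(m,4)·(n²(n²−1)/12) + (m²(m²−1)/12)·C(n,4)`. -/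
theorem dim_quadratic_relations_minors (m n : ℕ) (hm : 1 ≤ m) (hn : 1 ≤ n) :
    Module.finrank ℂ (kerPsiDeg m n 2) =
      Nat.choose m 4 * (n ^ 2 * (n ^ 2 - 1) / 12) +
        m ^ 2 * (m ^ 2 - 1) / 12 * Nat.choose n 4 := by
  rw [QRel.finrank_ker, QRel.finrank_KT']
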